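/- Let (X, d) be a metric space and T : X → X a nonexpansive map. If u ∈ X and v ∈ ω(u) is periodic, i.e. T^p v = v for some integer p ≥ 1, then ω(u) is exactly the finite orbit {v, T v, …, T^{p−1} v} of v. -/

import Mathlib

/-- The ω-limit set of a point `u` under iteration of `T`: the set of points `w` such that
for every `ε > 0` and every `N` there exists `k ≥ N` with `dist (T^[k] u) w < ε`. -/
def omegaLimitSet {X : Type*} [MetricSpace X] (T : X → X) (u : X) : Set X :=
  {w | ∀ ε > (0 : ℝ), ∀ N : ℕ, ∃ k ≥ N, dist (T^[k] u) w < ε}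

/-- Iterates of a nonexpansive map are nonexpansive. -/
theorem dist_iterate_le_of_nonexpansive {X : Type*} [MetricSpace X] {T : X → X}
    (hT : ∀ a b : X, dist (T a) (T b) ≤ dist a b) (n : ℕ) (a b : X) :
    dist (T^[n] a) (T^[n] b) ≤ dist a b := by
  simpa using ((LipschitzWith.mk_one hT).iterate n).dist_le_mul a b

/-- If `v ∈ ω(u)`, the whole forward orbit of `v` lies in `ω(u)`. -/
theorem iterate_mem_omegaLimitSet {X : Type*} [MetricSpace X] {T : X → X}
    (hT : ∀ a b : X, dist (T a) (T b) ≤ dist a b) {u v : X} (hv : v ∈ omegaLimitSet T u)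
    (i : ℕ) : T^[i] v ∈ omegaLimitSet T u := by
  intro ε hε N
  obtain ⟨k, hk, hd⟩ := hv ε hε N
  refine ⟨i + k, by omega, ?_⟩
  rw [Function.iterate_add_apply]
  exact (dist_iterate_le_of_nonexpansive hT i _ _).trans_lt hd

/-- If `v ∈ ω(u)`, then `ω(u)` is contained in the closure of the forward orbit of `v`. -/
theorem omegaLimitSet_subset_closure_orbit {X : Type*} [MetricSpace X] {T : X → X}
    (hT : ∀ a b : X, dist (T a) (T b) ≤ dist a b) {u v : X} (hv : v ∈ omegaLimitSet T u) :
    omegaLimitSet T u ⊆ closure (Set.range fun n => T^[n] v) := by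
  intro w hw
  refine Metric.mem_closure_range_iff.2 fun ε hε => ?_
  obtain ⟨k, -, hk⟩ := hv (ε / 2) (half_pos hε) 0
  obtain ⟨m, hm, hmw⟩ := hw (ε / 2) (half_pos hε) k
  obtain ⟨j, rfl⟩ := Nat.exists_eq_add_of_le' hm
  rw [Function.iterate_add_apply] at hmw
  refine ⟨j, ?_⟩
  have hj := dist_iterate_le_of_nonexpansive hT j (T^[k] u) v
  have htri := dist_triangle_left w (T^[j] v) (T^[j] (T^[k] u))
  linarith

/-- For a nonexpansive map `T` on a metric space, if `v ∈ ω(u)` is periodic with period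
`p ≥ 1` (i.e. `T^[p] v = v`), then `ω(u)` is exactly the finite orbit
`{v, T v, …, T^[p-1] v}` of `v`. -/
theorem omegaLimit_eq_periodic_orbit_of_nonexpansive {X : Type*} [MetricSpace X] (T : X → X)
    (hT : ∀ a b : X, dist (T a) (T b) ≤ dist a b) (u v : X) (hv : v ∈ omegaLimitSet T u)
    (p : ℕ) (hp : 1 ≤ p) (hper : T^[p] v = v) :
    omegaLimitSet T u = {w | ∃ i < p, w = T^[i] v} := by
  have horbit : (Set.range fun n => T^[n] v) = {w | ∃ i < p, w = T^[i] v} := by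
    ext w
    constructor
    · rintro ⟨n, rfl⟩
      exact ⟨n % p, Nat.mod_lt n hp, (Function.IsPeriodicPt.iterate_mod_apply hper n).symm⟩
    · rintro ⟨i, -, rfl⟩
      exact ⟨i, rfl⟩
  have hfin : {w | ∃ i < p, w = T^[i] v}.Finite :=
    ((Set.finite_lt_nat p).image fun i => T^[i] v).subset fun w ⟨i, hi, hw⟩ => ⟨i, hi, hw.symm⟩
  apply Set.Subset.antisymm
  · rw [← hfin.isClosed.closure_eq, ← horbit]
    exact omegaLimitSet_subset_closure_orbit hT hv
  · rintro w ⟨i, -, rfl⟩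
    exact iterate_mem_omegaLimitSet hT hv i
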